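/- (Type III, mixed type.) Let R = (R_{ij}) be a complex 3×3 matrix with R12 = R21 = R23 = R32 = 0. Then the constant R-deformation H_R of the Poisson bivector H of the subregular classical finite W-algebra of sl3 satisfies the Jacobi identity if and only if R11² = R33², i.e., R11 = ±R33. -/

import Mathlib

open MvPolynomial

/-- The Poisson bivector of the subregular classical finite W-algebra of `sl₃`:
`H¹² = −2u₁`, `H¹³ = u₂²`, `H²³ = −2u₃`, extended skew-symmetrically. -/
noncomputable def Hmat : Matrix (Fin 3) (Fin 3) (MvPolynomial (Fin 3) ℂ) :=
  !![0, -(2 * X 0), (X 1) ^ 2;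
     2 * X 0, 0, -(2 * X 2);
     -((X 1) ^ 2), 2 * X 2, 0]

/-- A `3×3` matrix of polynomials satisfies the Jacobi identity if for all `i j k`,
`Σ_l ( P^{il}·∂P^{jk}/∂u_l + P^{jl}·∂P^{ki}/∂u_l + P^{kl}·∂P^{ij}/∂u_l ) = 0`. -/
def JacobiId (P : Matrix (Fin 3) (Fin 3) (MvPolynomial (Fin 3) ℂ)) : Prop :=
  ∀ i j k : Fin 3,
    ∑ l : Fin 3,
      (P i l * pderiv l (P j k) + P j l * pderiv l (P k i) + P k l * pderiv l (P i j)) = 0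

/-- The constant `R`-deformation of a bivector `P`:
`P_R^{ij} = Σ_k ( R_{ik}·P^{kj} + R_{jk}·P^{ik} )`. -/
noncomputable def Rdef (R : Matrix (Fin 3) (Fin 3) ℂ)
    (P : Matrix (Fin 3) (Fin 3) (MvPolynomial (Fin 3) ℂ)) :
    Matrix (Fin 3) (Fin 3) (MvPolynomial (Fin 3) ℂ) :=
  Matrix.of fun i j => ∑ k : Fin 3, (C (R i k) * P k j + C (R j k) * P i k)

/-- The cyclic sum whose vanishing is the Jacobi identity. -/
noncomputable def jacobiator (P : Matrix (Fin 3) (Fin 3) (MvPolynomial (Fin 3) ℂ))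
    (i j k : Fin 3) : MvPolynomial (Fin 3) ℂ :=
  ∑ l : Fin 3,
    (P i l * pderiv l (P j k) + P j l * pderiv l (P k i) + P k l * pderiv l (P i j))

/-- In three variables, a skew-symmetric matrix satisfies the Jacobi identity as soon as its
only independent jacobiator vanishes. -/
theorem jacobiId_iff_of_skew {P : Matrix (Fin 3) (Fin 3) (MvPolynomial (Fin 3) ℂ)}
    (hP : ∀ i j, P j i = -P i j) : JacobiId P ↔ jacobiator P 0 1 2 = 0 := by
  refine ⟨fun h => h 0 1 2, fun h i j k => ?_⟩
  change jacobiator P i j k = 0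
  have hcyc (i j k : Fin 3) : jacobiator P j k i = jacobiator P i j k :=
    Finset.sum_congr rfl fun _ _ => by ring
  have hswap (i j k : Fin 3) : jacobiator P j i k = -jacobiator P i j k := by
    simp only [jacobiator, ← Finset.sum_neg_distrib]
    refine Finset.sum_congr rfl fun l _ => ?_
    rw [hP k i, hP j k, hP i j]
    simp only [map_neg]
    ring
  have hrep (i k : Fin 3) : jacobiator P i i k = 0 := self_eq_neg.mp (hswap i i k)
  have hrep' (i k : Fin 3) : jacobiator P i k i = 0 := (hcyc i i k).trans (hrep i k)
  have hrep'' (i k : Fin 3) : jacobiator P k i i = 0 := (hcyc k i i).symm.trans (hrep i k)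
  fin_cases i <;> fin_cases j <;> fin_cases k <;>
    simp [hrep, hrep', hrep'', h, hcyc 0 1 2, hcyc 1 2 0, hswap 0 1 2, hswap 1 2 0, hswap 2 0 1]

theorem Hmat_skew (i j : Fin 3) : Hmat j i = -Hmat i j := by
  fin_cases i <;> fin_cases j <;> simp [Hmat]

theorem Rdef_skew (R : Matrix (Fin 3) (Fin 3) ℂ)
    {P : Matrix (Fin 3) (Fin 3) (MvPolynomial (Fin 3) ℂ)} (hP : ∀ i j, P j i = -P i j)
    (i j : Fin 3) : Rdef R P j i = -Rdef R P i j := by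
  simp only [Rdef, Matrix.of_apply, ← Finset.sum_neg_distrib]
  refine Finset.sum_congr rfl fun k _ => ?_
  rw [hP i k, hP k j]
  ring

theorem jacobiator_Rdef_Hmat (R : Matrix (Fin 3) (Fin 3) ℂ)
    (h12 : R 0 1 = 0) (h21 : R 1 0 = 0) (h23 : R 1 2 = 0) (h32 : R 2 1 = 0) :
    jacobiator (Rdef R Hmat) 0 1 2 = C (R 0 0 ^ 2 - R 2 2 ^ 2) * (2 * X 1 ^ 2) := by
  have h2 (l : Fin 3) : pderiv l (2 : MvPolynomial (Fin 3) ℂ) = 0 := by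
    rw [← map_ofNat C 2, pderiv_C]
  simp [jacobiator, Rdef, Hmat, Fin.sum_univ_three, h12, h21, h23, h32, h2, pderiv_X,
    Pi.single_apply]
  ring

/-- (Type III, mixed type.) For a matrix `R` with `R₁₂ = R₂₁ = R₂₃ = R₃₂ = 0`, the
constant `R`-deformation `H_R` satisfies the Jacobi identity if and only if
`R₁₁² = R₃₃²`, i.e. `R₁₁ = ±R₃₃`. -/
theorem stmt3 (R : Matrix (Fin 3) (Fin 3) ℂ)
    (h12 : R 0 1 = 0) (h21 : R 1 0 = 0) (h23 : R 1 2 = 0) (h32 : R 2 1 = 0) :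
    JacobiId (Rdef R Hmat) ↔ R 0 0 ^ 2 = R 2 2 ^ 2 := by
  rw [jacobiId_iff_of_skew (Rdef_skew R Hmat_skew), jacobiator_Rdef_Hmat R h12 h21 h23 h32,
    mul_eq_zero, C_eq_zero, sub_eq_zero]
  simp
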